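/- There exists P ⊆ ℕ such that the spacing shift (Σ_P, σ_P) has positive topological entropy but has no non-zero periodic point; equivalently, h_{σ_P} > 0 and for every k ≥ 1 the set kℕ = {k, 2k, 3k, …} is not contained in P. -/

import Mathlib

open Filter Topology

/-- The spacing shift `Σ_P ⊆ {0,1}^ℕ` determined by `P ⊆ ℕ`: a `0`-`1` sequence `x`
(encoded as `x : ℕ → Bool`) belongs to `Σ_P` iff whenever two coordinates are `1`,
the (positive) distance between them lies in `P`. -/
def SpacingShift (P : Set ℕ) : Set (ℕ → Bool) :=
  {x | ∀ i j : ℕ, i < j → x i = true → x j = true → j - i ∈ P}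

/-- The left shift map `σ` on sequences. -/
def shift (x : ℕ → Bool) : ℕ → Bool := fun n => x (n + 1)

/-- The support `A_y = {i : y_i = 1}` of a point of the shift space. -/
def supp (x : ℕ → Bool) : Set ℕ := {i | x i = true}

/-- `A ⊆ ℕ` has density `d`, i.e. `|A ∩ {1,…,n}| / n → d`. -/
def HasDensity (A : Set ℕ) (d : ℝ) : Prop :=
  Tendsto (fun n : ℕ => (Nat.card (A ∩ Set.Icc 1 n : Set ℕ) : ℝ) / n) atTop (𝓝 d)

/-- The upper density `d̄(A) = limsup_n |A ∩ {1,…,n}| / n`. -/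
noncomputable def upperDensity (A : Set ℕ) : ℝ :=
  limsup (fun n : ℕ => (Nat.card (A ∩ Set.Icc 1 n : Set ℕ) : ℝ) / n) atTop

/-- The upper Banach density `d*(A)`: the limsup, as the window length tends to infinity,
of the maximal proportion of elements of `A` in a window of that length. -/
noncomputable def upperBanachDensity (A : Set ℕ) : ℝ :=
  limsup (fun n : ℕ =>
    ⨆ m : ℕ, (Nat.card (A ∩ Set.Icc m (m + n) : Set ℕ) : ℝ) / (n + 1)) atTop

/-- `D ⊆ ℕ` is a Δ-set: it contains the difference set `{s_i - s_j : i > j}` of some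
strictly increasing sequence of natural numbers. -/
def IsDeltaSet (D : Set ℕ) : Prop :=
  ∃ s : ℕ → ℕ, StrictMono s ∧ ∀ i j : ℕ, j < i → s i - s j ∈ D

/-- `D ⊆ ℕ` is a Δ*-set: it meets every Δ-set. -/
def IsDeltaStarSet (D : Set ℕ) : Prop :=
  ∀ D' : Set ℕ, IsDeltaSet D' → (D ∩ D').Nonempty

open Classical in
/-- The standard metric on the shift space: `d(x,y) = 2^{-min{n : x_n ≠ y_n}}`,
and `d(x,x) = 0`. -/
noncomputable def seqDist (x y : ℕ → Bool) : ℝ :=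
  if x = y then 0 else (2 : ℝ)⁻¹ ^ sInf {n : ℕ | x n ≠ y n}

/-- The set `FS((a_n))` of finite sums of a sequence of natural numbers:
all sums `a_{i_1} + ⋯ + a_{i_k}` with `i_1 < ⋯ < i_k`. -/
def FSseq (a : ℕ → ℕ) : Set ℕ :=
  {n | ∃ F : Finset ℕ, F.Nonempty ∧ n = ∑ i ∈ F, a i}

/-- `S ⊆ ℕ` is an IP-set: it contains the finite sums of some sequence of positive
natural numbers. -/
def IsIPSet (S : Set ℕ) : Prop :=
  ∃ a : ℕ → ℕ, (∀ n, 0 < a n) ∧ FSseq a ⊆ S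

/-- The set `FS(A)` of finite sums of distinct elements of a set `A ⊆ ℕ`. -/
def FSset (A : Set ℕ) : Set ℕ :=
  {n | ∃ F : Finset ℕ, ↑F ⊆ A ∧ F.Nonempty ∧ n = ∑ i ∈ F, i}

/-- The spacing shift `(Σ_P, σ_P)` is topologically transitive: some point of `Σ_P`
has forward orbit (under the shift) dense in `Σ_P`. -/
def IsTransitiveShift (P : Set ℕ) : Prop :=
  ∃ x ∈ SpacingShift P, SpacingShift P ⊆ closure {y : ℕ → Bool | ∃ n : ℕ, shift^[n] x = y}

/-- `E ⊆ ℕ` is density intersective: it meets the difference set `A - A` of every set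
`A ⊆ ℕ` of positive upper Banach density. -/
def DensityIntersective (E : Set ℕ) : Prop :=
  ∀ A : Set ℕ, 0 < upperBanachDensity A → ∃ a ∈ A, ∃ a' ∈ A, a' < a ∧ a - a' ∈ E

/-- Coordinates of the `n`-th iterate of the shift. -/
theorem shift_iterate_apply (x : ℕ → Bool) (n i : ℕ) : shift^[n] x i = x (i + n) := by
  induction n generalizing x with
  | zero => rfl
  | succ n ih =>
    rw [Function.iterate_succ_apply, ih]
    simp only [shift]
    congr 1

/-- If `P` contains all the positive differences of a sequence `a` of linear growth, then the
spacing shift of `P` has positive topological entropy. -/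
theorem coverEntropy_spacingShift_pos {P : Set ℕ} {a : ℕ → ℕ} (ha : Function.Injective a)
    {c : ℕ} (hc : c ≠ 0) (hac : ∀ j, a j < c * (j + 1))
    (hP : ∀ i j, a i < a j → a j - a i ∈ P) :
    0 < Dynamics.coverEntropy shift (SpacingShift P) := by
  classical
  let U : SetRel (ℕ → Bool) (ℕ → Bool) := {p | p.1 0 = p.2 0}
  have hU : U ∈ uniformity (ℕ → Bool) := by
    have h : {p : Bool × Bool | p.1 = p.2} ∈ uniformity Bool :=
      fun _ hp => hp
    exact Pi.uniformContinuous_proj (fun _ : ℕ => Bool) 0 h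
  refine lt_of_lt_of_le ?_ (Dynamics.netEntropyEntourage_le_coverEntropy _ _ hU)
  let x : Finset ℕ → ℕ → Bool := fun S i => decide (∃ j ∈ S, a j = i)
  have hxa : ∀ S j, x S (a j) = true ↔ j ∈ S := fun S j => by
    simp [x, ha.eq_iff]
  have hx : Function.Injective x := fun S T h => by
    ext j
    rw [← hxa, ← hxa, h]
  have hnet : ∀ n, Dynamics.IsDynNetIn shift (SpacingShift P) U (c * n)
      ((Finset.range n).powerset.image x : Finset (ℕ → Bool)) := by
    intro n
    constructor
    · intro y hy
      obtain ⟨S, -, rfl⟩ := Finset.mem_image.1 (Finset.mem_coe.1 hy)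
      intro i j hij hi hj
      obtain ⟨p, -, rfl⟩ := of_decide_eq_true hi
      obtain ⟨q, -, rfl⟩ := of_decide_eq_true hj
      exact hP p q hij
    · intro y hy z hz hyz
      obtain ⟨S, hS, rfl⟩ := Finset.mem_image.1 (Finset.mem_coe.1 hy)
      obtain ⟨T, hT, rfl⟩ := Finset.mem_image.1 (Finset.mem_coe.1 hz)
      rw [Function.onFun, Set.disjoint_left]
      intro w hwS hwT
      rw [Dynamics.mem_ball_dynEntourage] at hwS hwT
      refine hyz (congrArg x ?_)
      have key : ∀ j < n, (j ∈ S ↔ j ∈ T) := by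
        intro j hj
        have hlt : a j < c * n := (hac j).trans_le (Nat.mul_le_mul_left c hj)
        have h1 : shift^[a j] (x S) 0 = shift^[a j] w 0 := hwS (a j) hlt
        have h2 : shift^[a j] (x T) 0 = shift^[a j] w 0 := hwT (a j) hlt
        rw [← h2, shift_iterate_apply, shift_iterate_apply, zero_add] at h1
        rw [← hxa, ← hxa, h1]
      ext j
      by_cases hj : j < n
      · exact key j hj
      · rw [Finset.mem_powerset] at hS hT
        exact ⟨fun h => absurd (Finset.mem_range.1 (hS h)) hj,
          fun h => absurd (Finset.mem_range.1 (hT h)) hj⟩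
  let u : ℕ → ENNReal := fun n => (Dynamics.netMaxcard shift (SpacingShift P) U n : ENNReal)
  have hu : Monotone u := fun m n hmn =>
    ENat.toENNReal_le.2 (Dynamics.netMaxcard_monotone_time _ _ _ hmn)
  have hle : (fun n => (2 : ENNReal) ^ n) ≤ fun n => u (c * n) := by
    intro n
    have h := (hnet n).card_le_netMaxcard
    rw [Finset.card_image_of_injective _ hx, Finset.card_powerset, Finset.card_range] at h
    simpa [u] using ENat.toENNReal_le.2 h
  have h := ExpGrowth.expGrowthSup_monotone hle
  rw [ExpGrowth.expGrowthSup_pow] at h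
  have hlog : 0 < ENNReal.log 2 := ENNReal.zero_lt_log_iff.2 (by norm_num)
  have hcomp := hu.expGrowthSup_comp_mul hc
  have hpos : 0 < (c : EReal) * ExpGrowth.expGrowthSup u := by
    rw [← hcomp]
    exact hlog.trans_le h
  by_contra hneg
  exact absurd hpos (not_lt.2 (EReal.mul_nonpos_iff.2 (Or.inl ⟨by positivity, not_lt.1 hneg⟩)))

/-- Some positive multiple of an irrational number has distance at least `1 / 4` to the
integers. -/
theorem Irrational.exists_quarter_le_abs_mul_sub {θ : ℝ} (hθ : Irrational θ) :
    ∃ m : ℕ, 0 < m ∧ ∀ z : ℤ, 1 / 4 ≤ |m * θ - z| := by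
  by_contra! hcon
  obtain ⟨w, hw⟩ := hcon 1 one_pos
  rw [Nat.cast_one, one_mul] at hw
  have hbound : ∀ m : ℕ, |m * (θ - w)| < 1 / 4 := by
    intro m
    induction m with
    | zero => norm_num
    | succ m ih =>
      obtain ⟨z, hz⟩ := hcon (m + 1) m.succ_pos
      rw [abs_lt] at ih hw hz ⊢
      push_cast at hz ⊢
      have h1 : ((z - (m + 1) * w : ℤ) : ℝ) < 1 := by
        push_cast
        linarith
      have h2 : (-1 : ℝ) < ((z - (m + 1) * w : ℤ) : ℝ) := by
        push_cast
        linarith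
      have h0 : z - (m + 1) * w = 0 := by
        have h1' : z - (m + 1) * w < 1 := by exact_mod_cast h1
        have h2' : -1 < z - (m + 1) * w := by exact_mod_cast h2
        omega
      have h0' : (z : ℝ) - (m + 1) * w = 0 := by exact_mod_cast h0
      constructor <;> linarith
  have hne : 0 < |θ - w| := abs_pos.2 (sub_ne_zero.2 (hθ.ne_int w))
  obtain ⟨m, hm⟩ := Archimedean.arch (1 / 4 : ℝ) hne
  have := hbound m
  rw [abs_mul, Nat.abs_cast] at this
  rw [nsmul_eq_mul] at hm
  linarith

/-- A spacing shift with a non-zero point of period `m` contains all positive multiples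
of `m` among its spacings. -/
theorem mul_mem_of_shift_iterate_eq {P : Set ℕ} {y : ℕ → Bool} (hy : y ∈ SpacingShift P) {m : ℕ}
    (hm : 0 < m) (hper : shift^[m] y = y) {i : ℕ} (hi : y i = true) {l : ℕ} (hl : 0 < l) :
    m * l ∈ P := by
  have h : y (i + m * l) = true := by
    rw [← shift_iterate_apply y, Function.iterate_mul, Function.iterate_fixed hper, hi]
  simpa using hy i (i + m * l) (Nat.lt_add_of_pos_right (Nat.mul_pos hm hl)) hi h

/-- The multiples of `α` by the integers `⌈j / α⌉₊` lie just above the integers. -/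
theorem mul_ceil_div_mem_Ico {α : ℝ} (hα : 0 < α) (j : ℕ) :
    α * ⌈(j : ℝ) / α⌉₊ ∈ Set.Ico (j : ℝ) (j + α) := by
  have h1 := Nat.le_ceil ((j : ℝ) / α)
  have h2 := Nat.ceil_lt_add_one (show 0 ≤ (j : ℝ) / α by positivity)
  have h3 : α * ((j : ℝ) / α) = j := by field_simp
  constructor <;> nlinarith

/-- There is `P ⊆ ℕ` such that `(Σ_P, σ_P)` has positive topological
entropy but no non-zero periodic point; equivalently `h_{σ_P} > 0` and `kℕ ⊄ P` for
every `k ≥ 1`. -/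
theorem exists_pos_entropy_no_nonzero_periodic_point :
    ∃ P : Set ℕ, 0 < Dynamics.coverEntropy shift (SpacingShift P) ∧
      (∀ y ∈ SpacingShift P, ∀ m : ℕ, 0 < m → shift^[m] y = y → y = fun _ => false) ∧
      ∀ k : ℕ, 1 ≤ k → ¬ ({n : ℕ | ∃ m : ℕ, 0 < m ∧ n = k * m} ⊆ P) := by
  obtain ⟨α, hα, hα6, hα4⟩ : ∃ α : ℝ, Irrational α ∧ 1 / 6 < α ∧ α < 1 / 4 :=
    exists_irrational_btwn (by norm_num)
  have hα0 : 0 < α := by linarith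
  have hmul : ∀ k : ℕ, 1 ≤ k →
      ¬ ({n : ℕ | ∃ m : ℕ, 0 < m ∧ n = k * m} ⊆ {n : ℕ | ∃ z : ℤ, |n * α - z| < 1 / 4}) := by
    intro k hk hsub
    obtain ⟨m, hm, h⟩ := (hα.natCast_mul (m := k) (by omega)).exists_quarter_le_abs_mul_sub
    obtain ⟨z, hz⟩ := hsub ⟨m, hm, rfl⟩
    have := h z
    push_cast at hz
    rw [show (m : ℝ) * (k * α) = k * m * α by ring] at this
    linarith
  refine ⟨{n : ℕ | ∃ z : ℤ, |n * α - z| < 1 / 4}, ?_, ?_, hmul⟩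
  · refine coverEntropy_spacingShift_pos (a := fun j => ⌈(j : ℝ) / α⌉₊) (c := 6) ?_ (by norm_num)
      ?_ ?_
    · intro i j hij
      obtain ⟨h1, h2⟩ := mul_ceil_div_mem_Ico hα0 i
      obtain ⟨h3, h4⟩ := mul_ceil_div_mem_Ico hα0 j
      simp only at hij
      rw [hij] at h1 h2
      have h5 : (i : ℝ) < j + 1 := by linarith
      have h6 : (j : ℝ) < i + 1 := by linarith
      norm_cast at h5 h6
      omega
    · intro j
      obtain ⟨-, h2⟩ := mul_ceil_div_mem_Ico hα0 j
      have h : ((⌈(j : ℝ) / α⌉₊ : ℕ) : ℝ) < ((6 * (j + 1) : ℕ) : ℝ) := by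
        push_cast
        have hj : (0 : ℝ) ≤ j := j.cast_nonneg
        nlinarith
      exact_mod_cast h
    · intro i j hij
      obtain ⟨h1, h2⟩ := mul_ceil_div_mem_Ico hα0 i
      obtain ⟨h3, h4⟩ := mul_ceil_div_mem_Ico hα0 j
      refine ⟨(j : ℤ) - i, ?_⟩
      rw [Nat.cast_sub hij.le, abs_lt]
      push_cast
      constructor <;> linarith
  · intro y hy m hm hper
    by_contra hne
    obtain ⟨i, hi⟩ := Function.ne_iff.1 hne
    refine hmul m hm ?_
    rintro _ ⟨l, hl, rfl⟩
    exact mul_mem_of_shift_iterate_eq hy hm hper (by simpa using hi) hl
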